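/- Let μ ∈ A_W be a point of X(k), let α ∈ A_W satisfy q(μ,α) = 0 for all q ∈ Q, and let ξ ∈ End_k(W). Then there exists ν ∈ A_W such that for every q ∈ Q one has q(α + ξ•μ, α + ξ•μ) = q(α,α) + q(μ,ν). (That is, the quadratic obstruction α ↦ (q ↦ q(α,α)) is unchanged modulo the image of Φ_μ : ν ↦ (q ↦ q(μ,ν)) when α is replaced by α + δ_μ(ξ); hence the quadratic map κ descends to a well-defined map H²_inc(μ) → H³_inc(μ).) -/

import Mathlib

/-- The infinitesimal transport-of-structure action of `ξ ∈ End(W)` on a bilinear map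
`α : W × W → W`: `(ξ • α)(x,y) = ξ(α(x,y)) − α(ξx,y) − α(x,ξy)`. -/
def infAct {k W : Type*} [Field k] [AddCommGroup W] [Module k W]
    (ξ : Module.End k W) (α : W →ₗ[k] W →ₗ[k] W) : W →ₗ[k] W →ₗ[k] W :=
  α.compr₂ ξ - α.comp ξ - α.compl₂ ξ

/-- If `μ ∈ X(k)`, `α` satisfies `q(μ,α) = 0` for all `q ∈ Q`, and
`ξ ∈ End(W)`, then there is `ν ∈ A_W` with `q(α + ξ•μ, α + ξ•μ) = q(α,α) + q(μ,ν)` for every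
`q ∈ Q`: the quadratic obstruction is unchanged modulo `im Φ_μ` when `α` is replaced by
`α + δ_μ(ξ)`, so `κ` descends to `H²_inc(μ) → H³_inc(μ)`. -/
theorem stmt_5 (k : Type*) [Field k] [CharZero k]
    (W : Type*) [AddCommGroup W] [Module k W] [FiniteDimensional k W]
    (Q : Submodule k (LinearMap.BilinForm k (W →ₗ[k] W →ₗ[k] W)))
    (hsymm : ∀ q ∈ Q, ∀ a b : W →ₗ[k] W →ₗ[k] W, q a b = q b a)
    (hstab : ∀ q ∈ Q, ∀ ξ : Module.End k W, ∃ q' ∈ Q,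
      ∀ a b : W →ₗ[k] W →ₗ[k] W, q' a b = q (infAct ξ a) b + q a (infAct ξ b))
    (μ : W →ₗ[k] W →ₗ[k] W) (hμ : ∀ q ∈ Q, q μ μ = 0)
    (α : W →ₗ[k] W →ₗ[k] W) (hα : ∀ q ∈ Q, q μ α = 0)
    (ξ : Module.End k W) :
    ∃ ν : W →ₗ[k] W →ₗ[k] W, ∀ q ∈ Q,
      q (α + infAct ξ μ) (α + infAct ξ μ) = q α α + q μ ν := by
  have hbdry : ∀ q ∈ Q, q (infAct ξ μ) μ = 0 := by
    intro q hq
    obtain ⟨q', hq', h⟩ := hstab q hq ξ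
    have h1 := h μ μ
    rw [hμ q' hq', hsymm q hq μ (infAct ξ μ), ← two_mul] at h1
    exact (mul_eq_zero.mp h1.symm).resolve_left two_ne_zero
  refine ⟨-((2 : k) • infAct ξ α) - infAct ξ (infAct ξ μ), fun q hq => ?_⟩
  obtain ⟨q', hq', h⟩ := hstab q hq ξ
  have h1 := h μ α
  have h2 := h (infAct ξ μ) μ
  rw [hα q' hq'] at h1
  rw [hbdry q' hq', hsymm q hq (infAct ξ (infAct ξ μ)) μ] at h2
  simp only [map_add, map_sub, map_neg, map_smul, LinearMap.add_apply, smul_eq_mul]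
  rw [hsymm q hq α (infAct ξ μ)]
  linear_combination -2 * h1 - h2
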